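/- arXiv:1806.00274 — 4 statements merged into one kernel-verified Lean document; each statement's English description precedes it below -/
import Mathlib

section
/- Let N : ℝ × ℝ × ℝ → ℝ be continuous and satisfy the multiplicativity condition N(θ(t)·p, θ(t)·q, t) = θ(t)·N(p, q, t) for all p, q, t ∈ ℝ. Let s ∈ ℝ and let w₀ : ℝ → ℝ be twice continuously differentiable with w₀''(t) + N(w₀'(t), w₀(t), t) = 0 for all t, w₀(0) = 0 and w₀'(0) = s. Then the function G = θ·w₀ satisfies the Green's function equation G'' + N(G', G, t) = s·δ in the sense of distributions; explicitly, for every test function φ : ℝ → ℝ, ∫_ℝ θ(t)·w₀(t)·φ''(t) dt + ∫_ℝ N(θ(t)·w₀'(t), θ(t)·w₀(t), t)·φ(t) dt = s·φ(0). -/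
open MeasureTheory

/-- The Heaviside step function: `1` for `t ≥ 0` and `0` for `t < 0`. -/
noncomputable def heaviside (t : ℝ) : ℝ := if 0 ≤ t then 1 else 0

theorem integral_heaviside_mul (f : ℝ → ℝ) :
    ∫ t : ℝ, heaviside t * f t = ∫ t in Set.Ioi (0 : ℝ), f t := by
  rw [← integral_Ici_eq_integral_Ioi, ← integral_indicator measurableSet_Ici]
  congr 1
  ext t
  by_cases h : 0 ≤ t <;> simp [heaviside, h]

/-- Green's identity on the half-line, for a compactly supported `φ`. -/
theorem integral_Ioi_mul_deriv_deriv_sub {w φ : ℝ → ℝ} (hw : ContDiff ℝ 2 w)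
    (hφ : ContDiff ℝ 2 φ) (hc : HasCompactSupport φ) (a : ℝ) :
    (∫ t in Set.Ioi a, w t * deriv (deriv φ) t) -
      (∫ t in Set.Ioi a, deriv (deriv w) t * φ t) =
    deriv w a * φ a - w a * deriv φ a := by
  have hw' : ContDiff ℝ 1 (deriv w) := hw.deriv' (n := 1)
  have hφ' : ContDiff ℝ 1 (deriv φ) := hφ.deriv' (n := 1)
  have hw'' : Continuous (deriv (deriv w)) := hw'.continuous_deriv le_rfl
  have hφ'' : Continuous (deriv (deriv φ)) := hφ'.continuous_deriv le_rfl
  have hint₁ : Integrable (fun t => w t * deriv (deriv φ) t) :=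
    (hw.continuous.mul hφ'').integrable_of_hasCompactSupport hc.deriv.deriv.mul_left
  have hint₂ : Integrable (fun t => deriv (deriv w) t * φ t) :=
    (hw''.mul hφ.continuous).integrable_of_hasCompactSupport hc.mul_left
  have hF : ContDiff ℝ 1 (fun t => w t * deriv φ t - deriv w t * φ t) :=
    ((hw.of_le one_le_two).mul hφ').sub (hw'.mul (hφ.of_le one_le_two))
  have hFc : HasCompactSupport (fun t => w t * deriv φ t - deriv w t * φ t) :=
    hc.deriv.mul_left.sub hc.mul_left
  have hderiv (t : ℝ) : deriv (fun t => w t * deriv φ t - deriv w t * φ t) t =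
      w t * deriv (deriv φ) t - deriv (deriv w) t * φ t := by
    have h₁ := (hw.differentiable two_ne_zero t).hasDerivAt
    have h₂ := (hφ.differentiable two_ne_zero t).hasDerivAt
    have h₃ := (hw'.differentiable one_ne_zero t).hasDerivAt
    have h₄ := (hφ'.differentiable one_ne_zero t).hasDerivAt
    refine ((h₁.mul h₄).sub (h₃.mul h₂)).deriv.trans ?_
    ring
  rw [← integral_sub hint₁.integrableOn hint₂.integrableOn]
  simp_rw [← hderiv]
  rw [hFc.integral_Ioi_deriv_eq hF a]
  ring

/-- If `N` satisfies the multiplicativity condition and `w₀` solves the homogeneous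
Cauchy problem `w₀'' + N(w₀', w₀, t) = 0`, `w₀(0) = 0`, `w₀'(0) = s`, then
`G = θ·w₀` satisfies `G'' + N(G', G, t) = s·δ` in the sense of distributions. -/
theorem green_representation_deriv_nonlinearity
    (N : ℝ × ℝ × ℝ → ℝ) (hN : Continuous N)
    (hmul : ∀ p q t : ℝ,
      N (heaviside t * p, heaviside t * q, t) = heaviside t * N (p, q, t))
    (s : ℝ) (w₀ : ℝ → ℝ) (hw₀ : ContDiff ℝ 2 w₀)
    (hode : ∀ t : ℝ, deriv (deriv w₀) t + N (deriv w₀ t, w₀ t, t) = 0)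
    (hinit : w₀ 0 = 0) (hinit' : deriv w₀ 0 = s) :
    ∀ φ : ℝ → ℝ, ContDiff ℝ (⊤ : ℕ∞) φ → HasCompactSupport φ →
      (∫ t : ℝ, heaviside t * w₀ t * deriv (deriv φ) t) +
        (∫ t : ℝ, N (heaviside t * deriv w₀ t, heaviside t * w₀ t, t) * φ t) =
      s * φ 0 := by
  intro φ hφ hc
  have hN' (t : ℝ) : N (heaviside t * deriv w₀ t, heaviside t * w₀ t, t) * φ t =
      heaviside t * -(deriv (deriv w₀) t * φ t) := by
    rw [hmul, eq_neg_of_add_eq_zero_right (hode t)]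
    ring
  have hgreen := integral_Ioi_mul_deriv_deriv_sub hw₀ (contDiff_infty.mp hφ 2) hc 0
  simp_rw [hN', mul_assoc]
  rw [integral_heaviside_mul, integral_heaviside_mul, integral_neg, ← sub_eq_add_neg, hgreen,
    hinit, hinit']
  ring
end

section
/- Let n ≥ 3 be a natural number, a ≠ 0, α > 0, s > 0, and define w(χ) = (a/(α·(n−2)))·(−s^{2−n} + (s^{1−n} + (α·(n−1)/a)·χ)^{(n−2)/(n−1)}), where s^{2−n} and s^{1−n} are integer powers of the positive real s and the outer exponent (n−2)/(n−1) is a real power, on the open set of χ ∈ ℝ with s^{1−n} + (α·(n−1)/a)·χ > 0 (which contains 0). Then w(0) = 0, w'(0) = s, w'(χ) = (s^{1−n} + (α·(n−1)/a)·χ)^{1/(1−n)}, and a·w''(χ) + α·(w'(χ))^n = 0 for all χ in this set. -/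
/-- The derivative of a real power of a function affine in `x`, where that function is positive. -/
theorem hasDerivAt_affine_rpow {b k x : ℝ} (p : ℝ) (h : 0 < b + k * x) :
    HasDerivAt (fun y => (b + k * y) ^ p) (k * p * (b + k * x) ^ (p - 1)) x := by
  have hlin : HasDerivAt (fun y => b + k * y) k x := by
    simpa using ((hasDerivAt_id x).const_mul k).const_add b
  exact hlin.rpow_const (Or.inl h.ne')


/-- The explicit homogeneous Cauchy solution of the reduced ODE `a·w'' + α·(w')ⁿ = 0`
of the wave equation with nonlinear damping:
`w(χ) = (a/(α(n−2)))·(−s^{2−n} + (s^{1−n} + (α(n−1)/a)χ)^{(n−2)/(n−1)})` satisfies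
`w(0) = 0`, `w'(0) = s`, `w'(χ) = (s^{1−n} + (α(n−1)/a)χ)^{1/(1−n)}`, and
`a·w'' + α·(w')ⁿ = 0` wherever `s^{1−n} + (α(n−1)/a)χ > 0`. -/
theorem explicit_solution_nonlinear_damping (n : ℕ) (hn : 3 ≤ n)
    (a α s : ℝ) (ha : a ≠ 0) (hα : 0 < α) (hs : 0 < s)
    (w : ℝ → ℝ)
    (hw : ∀ χ : ℝ,
      w χ = (a / (α * ((n:ℝ) - 2))) *
        (-(s ^ ((2:ℤ) - n)) +
          (s ^ ((1:ℤ) - n) + (α * ((n:ℝ) - 1) / a) * χ) ^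
            (((n:ℝ) - 2) / ((n:ℝ) - 1)))) :
    w 0 = 0 ∧ deriv w 0 = s ∧
    (∀ χ : ℝ, 0 < s ^ ((1:ℤ) - n) + (α * ((n:ℝ) - 1) / a) * χ →
      deriv w χ =
        (s ^ ((1:ℤ) - n) + (α * ((n:ℝ) - 1) / a) * χ) ^ (1 / (1 - (n:ℝ))) ∧
      a * deriv (deriv w) χ + α * (deriv w χ) ^ n = 0) := by
  have hn' : (3 : ℝ) ≤ n := by exact_mod_cast hn
  have h1 : (n : ℝ) - 1 ≠ 0 := by linarith
  have h1' : 1 - (n : ℝ) ≠ 0 := by linarith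
  have h2 : (n : ℝ) - 2 ≠ 0 := by linarith
  have hα' : α ≠ 0 := hα.ne'
  have hb : s ^ ((1:ℤ) - n) = s ^ (1 - (n : ℝ)) := by
    rw [← Real.rpow_intCast]
    push_cast
    rfl
  have hb2 : s ^ ((2:ℤ) - n) = s ^ (2 - (n : ℝ)) := by
    rw [← Real.rpow_intCast]
    push_cast
    rfl
  have hderiv : ∀ χ : ℝ, 0 < s ^ ((1:ℤ) - n) + (α * ((n:ℝ) - 1) / a) * χ →
      deriv w χ =
        (s ^ ((1:ℤ) - n) + (α * ((n:ℝ) - 1) / a) * χ) ^ (1 / (1 - (n:ℝ))) := by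
    intro χ h
    have hd := ((hasDerivAt_affine_rpow (((n:ℝ) - 2) / ((n:ℝ) - 1)) h).const_add
      (-(s ^ ((2:ℤ) - n)))).const_mul (a / (α * ((n:ℝ) - 2)))
    rw [funext hw, hd.deriv]
    have hexp : ((n:ℝ) - 2) / ((n:ℝ) - 1) - 1 = 1 / (1 - (n:ℝ)) := by
      rw [div_sub_one h1, div_eq_div_iff h1 h1']
      ring
    rw [hexp, ← mul_assoc]
    have hcoef : a / (α * ((n:ℝ) - 2)) *
        (α * ((n:ℝ) - 1) / a * (((n:ℝ) - 2) / ((n:ℝ) - 1))) = 1 := by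
      field_simp
    rw [hcoef, one_mul]
  refine ⟨?_, ?_, fun χ h => ⟨hderiv χ h, ?_⟩⟩
  · have hexp : (1 - (n:ℝ)) * (((n:ℝ) - 2) / ((n:ℝ) - 1)) = 2 - n := by
      rw [← mul_div_assoc, div_eq_iff h1]
      ring
    rw [hw, mul_zero, add_zero, hb, hb2, ← Real.rpow_mul hs.le, hexp, neg_add_cancel, mul_zero]
  · rw [hderiv 0 (by simpa using zpow_pos hs _), mul_zero, add_zero, hb, ← Real.rpow_mul hs.le,
      mul_one_div_cancel h1', Real.rpow_one]
  · have hopen : ∀ᶠ y in nhds χ, 0 < s ^ ((1:ℤ) - n) + (α * ((n:ℝ) - 1) / a) * y :=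
      (by fun_prop : Continuous fun y : ℝ =>
        s ^ ((1:ℤ) - n) + (α * ((n:ℝ) - 1) / a) * y).continuousAt.eventually (lt_mem_nhds h)
    have hd := (hasDerivAt_affine_rpow (1 / (1 - (n:ℝ))) h).congr_of_eventuallyEq
      (hopen.mono hderiv)
    have hexp : 1 / (1 - (n:ℝ)) * n = 1 / (1 - (n:ℝ)) - 1 := by
      field_simp
      ring
    have hcoef : a * (α * ((n:ℝ) - 1) / a * (1 / (1 - (n:ℝ)))) = -α := by
      field_simp
      ring
    rw [hd.deriv, hderiv χ h, ← Real.rpow_mul_natCast h.le, hexp, ← mul_assoc, hcoef]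
    ring
end

section
/- Let s ∈ ℝ, set λ = √(2 + s²)/2 and μ = artanh(−s/(2λ)) (well-defined since |s/(2λ)| = |s|/√(2+s²) < 1), and define w(t) = ln(2λ²) − 2·ln(cosh(λ·t + μ)). Then w(0) = 0, w'(0) = s, and w''(t) + exp(w(t)) = 0 for all t ∈ ℝ. -/
/-- The inverse hyperbolic tangent, `artanh x = (1/2)·ln((1 + x)/(1 − x))`. -/
noncomputable def artanh (x : ℝ) : ℝ := Real.log ((1 + x) / (1 - x)) / 2

theorem tanh_artanh_of_mem_Ioo {x : ℝ} (hx : x ∈ Set.Ioo (-1) 1) :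
    Real.tanh (artanh x) = x := by
  have h : artanh x = Real.artanh x := by
    rw [Real.artanh_eq_half_log (Set.Ioo_subset_Icc_self hx), artanh]
    ring
  rw [h, Real.tanh_artanh hx]

theorem hasDerivAt_log_cosh_affine (a b t : ℝ) :
    HasDerivAt (fun t => Real.log (Real.cosh (a * t + b)))
      (a * (Real.sinh (a * t + b) / Real.cosh (a * t + b))) t := by
  have h : HasDerivAt (fun t => a * t + b) a t := by
    simpa using ((hasDerivAt_id t).const_mul a).add_const b
  refine (h.cosh.log (Real.cosh_pos _).ne').congr_deriv ?_
  ring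

theorem hasDerivAt_sinh_div_cosh_affine (a b t : ℝ) :
    HasDerivAt (fun t => Real.sinh (a * t + b) / Real.cosh (a * t + b))
      (a / Real.cosh (a * t + b) ^ 2) t := by
  have h : HasDerivAt (fun t => a * t + b) a t := by
    simpa using ((hasDerivAt_id t).const_mul a).add_const b
  refine (h.sinh.div h.cosh (Real.cosh_pos _).ne').congr_deriv ?_
  congr 1
  linear_combination a * Real.cosh_sq_sub_sinh_sq (a * t + b)

/-- Table 1 entry for the Liouville nonlinearity `exp(w)`: with
`λ = √(2 + s²)/2` and `μ = artanh(−s/(2λ))` (well-defined since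
`|s/(2λ)| = |s|/√(2+s²) < 1`), the function
`w(t) = ln(2λ²) − 2·ln(cosh(λt + μ))` satisfies `w(0) = 0`, `w'(0) = s` and
`w'' + e^w = 0`. -/
theorem explicit_solution_liouville (s lam μ : ℝ)
    (hlam : lam = Real.sqrt (2 + s ^ 2) / 2)
    (hμ : μ = artanh (-s / (2 * lam)))
    (w : ℝ → ℝ)
    (hw : ∀ t : ℝ,
      w t = Real.log (2 * lam ^ 2) - 2 * Real.log (Real.cosh (lam * t + μ))) :
    w 0 = 0 ∧ deriv w 0 = s ∧
    (∀ t : ℝ, deriv (deriv w) t + Real.exp (w t) = 0) := by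
  have hlam_pos : 0 < lam := by rw [hlam]; positivity
  have hlam_sq : 4 * lam ^ 2 = 2 + s ^ 2 := by
    rw [hlam, div_pow, Real.sq_sqrt (by positivity)]
    ring
  have hmem : -s / (2 * lam) ∈ Set.Ioo (-1) 1 := by
    rw [Set.mem_Ioo, ← abs_lt, ← sq_lt_one_iff_abs_lt_one, div_pow, div_lt_one (by positivity)]
    linarith
  have hc : ∀ x : ℝ, Real.cosh x ≠ 0 := fun x => (Real.cosh_pos x).ne'
  have htanh : Real.sinh μ / Real.cosh μ = -s / (2 * lam) := by
    rw [← Real.tanh_eq_sinh_div_cosh, hμ, tanh_artanh_of_mem_Ioo hmem]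
  have hcosh : 2 * lam ^ 2 = Real.cosh μ ^ 2 := by
    have h : Real.sinh μ * (2 * lam) = -s * Real.cosh μ :=
      (div_eq_div_iff (hc μ) (by positivity)).mp htanh
    linear_combination (-2 * lam ^ 2) * Real.cosh_sq_sub_sinh_sq μ
      + (1 / 2) * Real.cosh μ ^ 2 * hlam_sq
      - (1 / 2) * (Real.sinh μ * (2 * lam) - s * Real.cosh μ) * h
  have hderiv : deriv w =
      fun t => -2 * lam * (Real.sinh (lam * t + μ) / Real.cosh (lam * t + μ)) := by
    funext t
    rw [funext hw]
    convert (((hasDerivAt_log_cosh_affine lam μ t).const_mul 2).const_sub _).deriv using 1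
    ring
  refine ⟨?_, ?_, fun t => ?_⟩
  · rw [hw, hcosh, Real.log_pow]
    simp
  · simp only [hderiv, mul_zero, zero_add, htanh]
    field_simp
  · rw [hderiv, ((hasDerivAt_sinh_div_cosh_affine lam μ t).const_mul _).deriv, hw,
      Real.exp_sub, Real.exp_log (by positivity), two_mul (Real.log _), Real.exp_add,
      Real.exp_log (Real.cosh_pos _)]
    ring
end

section
/- Let g : ℝ → ℝ be continuous, let s ≠ 0, and let w : ℝ → ℝ be differentiable and satisfy the implicit relation ∫₀^{w(t)} (1/s + ∫₀^z g(ζ) dζ) dz = t for all t ∈ ℝ. Then w(0) = 0, 1/s + ∫₀^{w(t)} g(ζ) dζ ≠ 0 and w'(t) = (1/s + ∫₀^{w(t)} g(ζ) dζ)⁻¹ for all t (in particular w'(0) = s), w' is differentiable, and w''(t) + g(w(t))·(w'(t))³ = 0 for all t. -/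
open Filter Topology in
/-- A monotone map on `ℝ` with a continuous left inverse tends to infinity. -/
theorem Monotone.tendsto_atTop_of_leftInverse {F w : ℝ → ℝ} (hm : Monotone w)
    (hF : Continuous F) (h : Function.LeftInverse F w) : Tendsto w atTop atTop := by
  rcases tendsto_atTop_of_monotone hm with h1 | ⟨a, ha⟩
  · exact h1
  · have h2 : Tendsto (fun t => F (w t)) atTop (𝓝 (F a)) := (hF.tendsto a).comp ha
    simp only [h _] at h2
    exact absurd h2 (not_tendsto_nhds_of_tendsto_atTop tendsto_id _)

/-- A strictly monotone continuous map on `ℝ` with a continuous left inverse is surjective. -/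
theorem StrictMono.surjective_of_leftInverse {F w : ℝ → ℝ} (hm : StrictMono w)
    (hw : Continuous w) (hF : Continuous F) (h : Function.LeftInverse F w) :
    Function.Surjective w := by
  have h1 := hm.monotone.tendsto_atTop_of_leftInverse hF h
  have h2 : Filter.Tendsto (fun t => -w (-t)) Filter.atTop Filter.atTop := by
    refine Monotone.tendsto_atTop_of_leftInverse (F := fun y => -F (-y))
      (fun a b hab => neg_le_neg (hm.monotone (neg_le_neg hab))) (by fun_prop) fun t => ?_
    simp [h (-t)]
  refine hw.surjective h1 ?_
  have h3 := Filter.tendsto_neg_atTop_atBot.comp (h2.comp Filter.tendsto_neg_atBot_atTop)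
  simpa [Function.comp_def] using h3

/-- A continuous map on `ℝ` with a continuous left inverse is surjective. -/
theorem Continuous.surjective_of_leftInverse {F w : ℝ → ℝ} (hw : Continuous w)
    (hF : Continuous F) (h : Function.LeftInverse F w) : Function.Surjective w := by
  rcases hw.strictMono_of_inj h.injective with hm | hm
  · exact hm.surjective_of_leftInverse hw hF h
  · have h1 : Function.Surjective fun t => -w t :=
      StrictMono.surjective_of_leftInverse (F := fun y => F (-y)) hm.neg hw.neg (by fun_prop)
        fun t => by simp [h t]
    intro y
    obtain ⟨t, ht⟩ := h1 (-y)
    exact ⟨t, neg_injective ht⟩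


/-- Table 1 entry for the nonlinearity `g(w)·(w')³`: if `w` is differentiable and
satisfies the implicit relation `∫₀^{w(t)} (1/s + ∫₀^z g(ζ) dζ) dz = t`, then
`w(0) = 0`, `w'(t) = (1/s + ∫₀^{w(t)} g(ζ) dζ)⁻¹`, `w'` is differentiable, and
`w'' + g(w)·(w')³ = 0`. -/
theorem implicit_solution_g_wprime_cubed (g : ℝ → ℝ) (hg : Continuous g)
    (s : ℝ) (hs : s ≠ 0) (w : ℝ → ℝ) (hw : Differentiable ℝ w)
    (himp : ∀ t : ℝ,
      (∫ z in (0:ℝ)..(w t), (1 / s + ∫ ζ in (0:ℝ)..z, g ζ)) = t) :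
    w 0 = 0 ∧
    (∀ t : ℝ, (1 / s + ∫ ζ in (0:ℝ)..(w t), g ζ) ≠ 0 ∧
      deriv w t = (1 / s + ∫ ζ in (0:ℝ)..(w t), g ζ)⁻¹) ∧
    deriv w 0 = s ∧
    Differentiable ℝ (deriv w) ∧
    (∀ t : ℝ, deriv (deriv w) t + g (w t) * (deriv w t) ^ 3 = 0) := by
  have hG (y : ℝ) : HasDerivAt (fun z => 1 / s + ∫ ζ in (0 : ℝ)..z, g ζ) (g y) y :=
    (hg.integral_hasStrictDerivAt 0 y).hasDerivAt.const_add _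
  have hGc : Continuous fun z => 1 / s + ∫ ζ in (0 : ℝ)..z, g ζ :=
    continuous_iff_continuousAt.2 fun y => (hG y).continuousAt
  have hF (y : ℝ) := (hGc.integral_hasStrictDerivAt 0 y).hasDerivAt
  have hmul (t : ℝ) : (1 / s + ∫ ζ in (0 : ℝ)..(w t), g ζ) * deriv w t = 1 := by
    have h1 := (hF (w t)).comp t (hw t).hasDerivAt
    have h2 := (hasDerivAt_id t).congr_of_eventuallyEq (.of_forall himp)
    exact h1.unique h2
  have hne (t : ℝ) := left_ne_zero_of_mul_eq_one (hmul t)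
  have hder (t : ℝ) : deriv w t = (1 / s + ∫ ζ in (0 : ℝ)..(w t), g ζ)⁻¹ :=
    eq_inv_of_mul_eq_one_right (hmul t)
  have hw0 : w 0 = 0 := by
    obtain ⟨t, ht⟩ := hw.continuous.surjective_of_leftInverse
      (continuous_iff_continuousAt.2 fun y => (hF y).continuousAt) himp 0
    have h0 := himp t
    rw [ht, intervalIntegral.integral_same] at h0
    rwa [← h0] at ht
  have hder2 (t : ℝ) : HasDerivAt (deriv w) (-(g (w t) * deriv w t ^ 3)) t := by
    have h1 := ((hG (w t)).comp t (hw t).hasDerivAt).inv (hne t)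
    refine (h1.congr_of_eventuallyEq (.of_forall hder)).congr_deriv ?_
    simp only [Function.comp_apply]
    rw [hder t, neg_div, div_eq_mul_inv, ← inv_pow]
    ring
  refine ⟨hw0, fun t => ⟨hne t, hder t⟩, ?_, fun t => (hder2 t).differentiableAt, fun t => ?_⟩
  · simp [hder 0, hw0]
  · rw [(hder2 t).deriv, neg_add_cancel]
end
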